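/- Let 𝒜 = (Q,A,δ,λ) be an invertible transducer and G = G(𝒜). Then every point of the boundary A^ω has trivial stabilizer in G if and only if every periodic point has trivial stabilizer in G; that is, St(v) = {1} for all v ∈ A^ω if and only if St(w^ω) = {1} for all nonempty finite words w ∈ A^+. -/

import Mathlib

namespace Paper

variable {Q A T : Type*}

/-- Output action of a single state on a finite word. -/
def tOut (δ : Q → A → Q) (lam : Q → A → A) : Q → List A → List A
  | _, [] => []
  | q, a :: w => lam q a :: tOut δ lam (δ q a) w

/-- Output action of a word of states (leftmost letter acts first). -/
def wOut (δ : Q → A → Q) (lam : Q → A → A) (u : List Q) (w : List A) : List A :=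
  u.foldl (fun v q => tOut δ lam q v) w

/-- Section (dual action) of a word of states by a single letter. -/
def sec (δ : Q → A → Q) (lam : Q → A → A) : List Q → A → List Q
  | [], _ => []
  | q :: u, a => δ q a :: sec δ lam u (lam q a)

/-- Section of a word of states by a word of letters. -/
def secW (δ : Q → A → Q) (lam : Q → A → A) (u : List Q) (v : List A) : List Q :=
  v.foldl (sec δ lam) u

/-- Single step of the enriched alphabet `Q ⊕ Q` (second copy = formal inverses). -/
noncomputable def stepT [Nonempty A] (δ : Q → A → Q) (lam : Q → A → A) :
    Q ⊕ Q → A → (Q ⊕ Q) × A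
  | Sum.inl q, a => (Sum.inl (δ q a), lam q a)
  | Sum.inr q, a => (Sum.inr (δ q (Function.invFun (lam q) a)), Function.invFun (lam q) a)

noncomputable def tOutT [Nonempty A] (δ : Q → A → Q) (lam : Q → A → A) :
    Q ⊕ Q → List A → List A
  | _, [] => []
  | x, a :: w => (stepT δ lam x a).2 :: tOutT δ lam (stepT δ lam x a).1 w

noncomputable def wOutT [Nonempty A] (δ : Q → A → Q) (lam : Q → A → A)
    (u : List (Q ⊕ Q)) (w : List A) : List A :=
  u.foldl (fun v x => tOutT δ lam x v) w

noncomputable def secT [Nonempty A] (δ : Q → A → Q) (lam : Q → A → A) :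
    List (Q ⊕ Q) → A → List (Q ⊕ Q)
  | [], _ => []
  | x :: u, a => (stepT δ lam x a).1 :: secT δ lam u ((stepT δ lam x a).2)

noncomputable def secTW [Nonempty A] (δ : Q → A → Q) (lam : Q → A → A)
    (u : List (Q ⊕ Q)) (v : List A) : List (Q ⊕ Q) :=
  v.foldl (secT δ lam) u

/-- The automaton group as subgroup of the permutations of `A*`. -/
def autGroup (δ : Q → A → Q) (lam : Q → A → A) : Subgroup (Equiv.Perm (List A)) :=
  Subgroup.closure {g : Equiv.Perm (List A) | ∃ q : Q, ∀ w, g w = tOut δ lam q w}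

/-- Induced action of a length- and prefix-preserving map on the boundary. -/
def boundaryAct (g : List A → List A) (v : ℕ → A) : ℕ → A :=
  fun i => (g ((List.range (i + 1)).map v)).getD i (v i)

/-- The periodic sequence `w^ω`. -/
noncomputable def perSeq [Nonempty A] (w : List A) : ℕ → A :=
  fun i => w.getD (i % w.length) (Classical.arbitrary A)

/-- `u^n`: `n`-fold concatenation of a word with itself. -/
def rep (u : List A) (n : ℕ) : List A := (List.replicate n u).flatten

def Reversible (δ : Q → A → Q) : Prop := ∀ a, Function.Bijective (fun q => δ q a)

def Invertible' (lam : Q → A → A) : Prop := ∀ q, Function.Bijective (lam q)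

def Bireversible (δ : Q → A → Q) (lam : Q → A → A) : Prop :=
  Invertible' lam ∧ Reversible δ ∧
    ∀ q q' a a', lam q a = lam q' a' → δ q a = δ q' a' → (q, a) = (q', a')

def prodδ (δ₁ : Q → A → Q) (lam₁ : Q → A → A) (δ₂ : T → A → T) :
    Q × T → A → Q × T :=
  fun p a => (δ₁ p.1 a, δ₂ p.2 (lam₁ p.1 a))

def prodLam (lam₁ : Q → A → A) (lam₂ : T → A → A) : Q × T → A → A :=
  fun p a => lam₂ p.2 (lam₁ p.1 a)

end Paper

open Paper

namespace Paper

variable {Q A : Type*}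

theorem tOut_length (δ : Q → A → Q) (lam : Q → A → A) (q : Q) (w : List A) :
    (tOut δ lam q w).length = w.length := by
  induction w generalizing q with
  | nil => rfl
  | cons a w ih => simp [tOut, ih]

/-- The state reached from `q` after reading a word. -/
def stateAfter (δ : Q → A → Q) (q : Q) (p : List A) : Q := p.foldl δ q

theorem tOut_append (δ : Q → A → Q) (lam : Q → A → A) (q : Q) (p w : List A) :
    tOut δ lam q (p ++ w) = tOut δ lam q p ++ tOut δ lam (stateAfter δ q p) w := by
  induction p generalizing q with
  | nil => rfl
  | cons a p ih => simp [tOut, stateAfter, ih]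

theorem tOut_bijective {δ : Q → A → Q} {lam : Q → A → A}
    (hinv : ∀ q, Function.Bijective (lam q)) (q : Q) :
    Function.Bijective (tOut δ lam q) := by
  constructor
  · intro x y h
    induction x generalizing q y with
    | nil => cases y with
      | nil => rfl
      | cons b y => simp [tOut] at h
    | cons a x ih => cases y with
      | nil => simp [tOut] at h
      | cons b y =>
        simp only [tOut, List.cons.injEq] at h
        obtain rfl := (hinv q).1 h.1
        rw [ih _ h.2]
  · intro y
    induction y generalizing q with
    | nil => exact ⟨[], rfl⟩
    | cons b y ih =>
      obtain ⟨a, rfl⟩ := (hinv q).2 b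
      obtain ⟨x, rfl⟩ := ih (δ q a)
      exact ⟨a :: x, rfl⟩

/-- The permutation of words induced by a state of an invertible transducer. -/
noncomputable def statePerm {δ : Q → A → Q} {lam : Q → A → A}
    (hinv : ∀ q, Function.Bijective (lam q)) (q : Q) : Equiv.Perm (List A) :=
  Equiv.ofBijective (tOut δ lam q) (tOut_bijective hinv q)

theorem autGroup_length {δ : Q → A → Q} {lam : Q → A → A} {g : Equiv.Perm (List A)}
    (hg : g ∈ autGroup δ lam) (w : List A) : (g w).length = w.length := by
  induction hg using Subgroup.closure_induction generalizing w with
  | mem g hg =>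
    obtain ⟨q, hq⟩ := hg
    rw [hq, tOut_length]
  | one => rfl
  | mul g h _ _ ihg ihh => rw [Equiv.Perm.mul_apply, ihg, ihh]
  | inv g _ ih => simpa using (ih (g⁻¹ w)).symm

/-- Every element of the automaton group has finitely many sections, all in the group. -/
theorem autGroup_sections [Finite Q] {δ : Q → A → Q} {lam : Q → A → A}
    (hinv : ∀ q, Function.Bijective (lam q)) {g : Equiv.Perm (List A)}
    (hg : g ∈ autGroup δ lam) :
    ∃ S : Set (Equiv.Perm (List A)), S.Finite ∧ S ⊆ autGroup δ lam ∧
      ∀ p, ∃ h ∈ S, ∀ w, g (p ++ w) = g p ++ h w := by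
  induction hg using Subgroup.closure_induction with
  | mem g hg =>
    obtain ⟨q, hq⟩ := hg
    refine ⟨Set.range (statePerm (δ := δ) hinv), Set.finite_range _, ?_, fun p => ?_⟩
    · rintro _ ⟨r, rfl⟩
      exact Subgroup.subset_closure ⟨r, fun _ => rfl⟩
    · refine ⟨_, ⟨stateAfter δ q p, rfl⟩, fun w => ?_⟩
      rw [hq, hq, tOut_append]
      rfl
  | one =>
    exact ⟨{1}, Set.finite_singleton _, by simp, fun p => ⟨1, rfl, fun _ => rfl⟩⟩
  | mul g h _ _ ihg ihh =>
    obtain ⟨S, hS, hSG, hSsec⟩ := ihg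
    obtain ⟨T, hT, hTG, hTsec⟩ := ihh
    refine ⟨Set.image2 (· * ·) S T, hS.image2 _ hT, ?_, fun p => ?_⟩
    · rintro _ ⟨s, hs, t, ht, rfl⟩
      exact mul_mem (hSG hs) (hTG ht)
    · obtain ⟨t, ht, htp⟩ := hTsec p
      obtain ⟨s, hs, hsp⟩ := hSsec (h p)
      exact ⟨s * t, ⟨s, hs, t, ht, rfl⟩, fun w => by simp [htp, hsp]⟩
  | inv g _ ih =>
    obtain ⟨S, hS, hSG, hSsec⟩ := ih
    refine ⟨(·⁻¹) '' S, hS.image _, ?_, fun p => ?_⟩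
    · rintro _ ⟨s, hs, rfl⟩
      exact inv_mem (hSG hs)
    · obtain ⟨s, hs, hsp⟩ := hSsec (g⁻¹ p)
      refine ⟨s⁻¹, ⟨s, hs, rfl⟩, fun w => ?_⟩
      rw [Equiv.Perm.inv_eq_iff_eq, hsp]
      simp

/-- The prefix of length `n` of an infinite sequence. -/
def seqPrefix (v : ℕ → A) (n : ℕ) : List A := (List.range n).map v

@[simp] theorem seqPrefix_length (v : ℕ → A) (n : ℕ) : (seqPrefix v n).length = n := by
  simp [seqPrefix]

theorem seqPrefix_add (v : ℕ → A) (m n : ℕ) :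
    seqPrefix v (m + n) = seqPrefix v m ++ seqPrefix (fun i => v (m + i)) n := by
  simp [seqPrefix, List.range_add, Function.comp_def]

theorem boundaryAct_eq_self_iff [Finite Q] {δ : Q → A → Q} {lam : Q → A → A}
    (hinv : ∀ q, Function.Bijective (lam q)) {g : Equiv.Perm (List A)}
    (hg : g ∈ autGroup δ lam) (v : ℕ → A) :
    boundaryAct (⇑g) v = v ↔ ∀ n, g (seqPrefix v n) = seqPrefix v n := by
  constructor
  · intro hv n
    induction n with
    | zero => exact List.eq_nil_of_length_eq_zero (by rw [autGroup_length hg]; simp)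
    | succ n ih =>
      obtain ⟨S, -, hSG, hSsec⟩ := autGroup_sections hinv hg
      obtain ⟨h, hS, hh⟩ := hSsec (seqPrefix v n)
      have hvn := congrFun hv n
      obtain ⟨x, hx⟩ := List.length_eq_one_iff.1
        ((autGroup_length (hSG hS) [v n]).trans (by simp))
      change (g (seqPrefix v (n + 1))).getD n (v n) = v n at hvn
      have hsplit : seqPrefix v (n + 1) = seqPrefix v n ++ [v n] := by
        simp [seqPrefix, List.range_succ]
      rw [hsplit, hh, ih, hx] at hvn ⊢
      rw [List.getD_append_right _ _ _ _ (by simp)] at hvn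
      simp only [seqPrefix_length, Nat.sub_self, List.getD_cons_zero] at hvn
      rw [hvn]
  · intro hv
    funext i
    change (g (seqPrefix v (i + 1))).getD i (v i) = v i
    rw [hv]
    simp [seqPrefix]

theorem seqPrefix_perSeq [Nonempty A] (w : List A) (n : ℕ) :
    seqPrefix (perSeq w) (w.length + n) = w ++ seqPrefix (perSeq w) n := by
  rw [seqPrefix_add]
  congr 1
  · apply List.ext_getElem (by simp)
    intro i _ hi
    simp [seqPrefix, perSeq, Nat.mod_eq_of_lt hi, hi]
  · simp only [perSeq, Nat.add_mod_left]
    rfl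

theorem boundaryAct_perSeq_eq_self [Finite Q] [Nonempty A] {δ : Q → A → Q} {lam : Q → A → A}
    (hinv : ∀ q, Function.Bijective (lam q)) {g : Equiv.Perm (List A)}
    (hg : g ∈ autGroup δ lam) {w : List A} (hw : w ≠ [])
    (hfix : ∀ x, g x = x → g (w ++ x) = w ++ x) :
    boundaryAct (⇑g) (perSeq w) = perSeq w := by
  rw [boundaryAct_eq_self_iff hinv hg]
  have hpow (n : ℕ) : g (seqPrefix (perSeq w) (n * w.length)) =
      seqPrefix (perSeq w) (n * w.length) := by
    induction n with
    | zero =>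
      rw [Nat.zero_mul]
      exact List.eq_nil_of_length_eq_zero (by rw [autGroup_length hg]; simp)
    | succ n ih =>
      rw [Nat.succ_mul, Nat.add_comm, seqPrefix_perSeq]
      exact hfix _ ih
  intro n
  obtain ⟨r, hr⟩ := Nat.exists_eq_add_of_le
    (Nat.le_mul_of_pos_right n (List.length_pos_of_ne_nil hw))
  have hn := hpow n
  obtain ⟨S, -, -, hSsec⟩ := autGroup_sections hinv hg
  obtain ⟨h, -, hh⟩ := hSsec (seqPrefix (perSeq w) n)
  rw [hr, seqPrefix_add, hh] at hn
  exact (List.append_inj hn (autGroup_length hg _)).1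

end Paper

/-- all boundary stabilizers are trivial iff the stabilizers of all
periodic boundary points are trivial. -/
theorem statement_13 {Q A : Type*} [Fintype Q] [Fintype A] [Nonempty Q] [Nonempty A]
    (δ : Q → A → Q) (lam : Q → A → A) (hinv : ∀ q, Function.Bijective (lam q)) :
    (∀ v : ℕ → A, ∀ g ∈ autGroup δ lam, boundaryAct (⇑g) v = v → g = 1) ↔
    (∀ w : List A, w ≠ [] → ∀ g ∈ autGroup δ lam,
      boundaryAct (⇑g) (perSeq w) = perSeq w → g = 1) := by
  refine ⟨fun H w _ => H (perSeq w), fun H v g hg hv => ?_⟩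
  rw [boundaryAct_eq_self_iff hinv hg] at hv
  obtain ⟨S, hS, hSG, hSsec⟩ := autGroup_sections hinv hg
  choose s hsS hs using fun n => hSsec (seqPrefix v n)
  obtain ⟨i, j, hij, hsij⟩ := hS.exists_lt_map_eq_of_forall_mem hsS
  obtain ⟨k, rfl⟩ := Nat.exists_eq_add_of_lt hij
  rw [Nat.add_assoc] at hsij
  have hsi : s i = 1 := by
    refine H (seqPrefix (fun l => v (i + l)) (k + 1))
      (List.ne_nil_of_length_pos (by simp)) _ (hSG (hsS i))
      (boundaryAct_perSeq_eq_self hinv (hSG (hsS i))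
        (List.ne_nil_of_length_pos (by simp)) fun x hx => ?_)
    have h := hs (i + (k + 1)) x
    rw [hv, ← hsij, hx, seqPrefix_add, List.append_assoc, hs, hv] at h
    simpa using h
  have hfix (x : List A) : g (seqPrefix v i ++ x) = seqPrefix v i ++ x := by
    rw [hs, hv, hsi, Equiv.Perm.one_apply]
  by_cases hp : seqPrefix v i = []
  · ext1 x
    simpa [hp] using hfix x
  · exact H _ hp g hg (boundaryAct_perSeq_eq_self hinv hg hp fun x _ => hfix x)
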